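/- Let m be a natural number, let e₁, e₂ : ℤ^m → ℤ be affine functions, and let S be a Presburger-definable subset of ℤ^m × ℤ. Define D = {p ∈ ℤ^m | ∃ v ∈ ℤ, e₁ p ≤ v ∧ v ≤ e₂ p ∧ (p,v) ∈ S}. Then D is a Presburger-definable subset of ℤ^m; moreover, for each p ∈ D the set {v ∈ ℤ | e₁ p ≤ v ≤ e₂ p ∧ (p,v) ∈ S} has a greatest element, and the function sending p ∈ D to this greatest element is piecewise quasi-affine on D. (This is the correctness property of the paper's Fold operation, equation (3), which computes the effect of a do-loop as max{v ∈ [e₁,e₂] | T(v) evaluates to a term}.) -/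

import Mathlib

/-- An affine function `ℤ^n → ℤ`: `x ↦ b + ∑ i, a i * x i` with integer
coefficients `a i` and integer constant `b`. -/
def IsAffine {n : ℕ} (f : (Fin n → ℤ) → ℤ) : Prop :=
  ∃ (a : Fin n → ℤ) (b : ℤ), ∀ x, f x = b + ∑ i, a i * x i

/-- Presburger-definable subsets of `ℤ^n`: the smallest collection containing
`{x | f x ≥ 0}` for affine `f` and `{x | (m : ℤ) ∣ f x}` for affine `f` and
positive integers `m`, closed under (finite) unions, intersections and
complements. -/
inductive Presburger : ∀ {n : ℕ}, Set (Fin n → ℤ) → Prop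
  | affineGe {n : ℕ} (f : (Fin n → ℤ) → ℤ) (hf : IsAffine f) :
      Presburger {x | 0 ≤ f x}
  | dvd {n : ℕ} (m : ℕ) (hm : 0 < m) (f : (Fin n → ℤ) → ℤ) (hf : IsAffine f) :
      Presburger {x | (m : ℤ) ∣ f x}
  | union {n : ℕ} {S T : Set (Fin n → ℤ)} : Presburger S → Presburger T → Presburger (S ∪ T)
  | inter {n : ℕ} {S T : Set (Fin n → ℤ)} : Presburger S → Presburger T → Presburger (S ∩ T)
  | compl {n : ℕ} {S : Set (Fin n → ℤ)} : Presburger S → Presburger Sᶜ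

/-- Quasi-affine functions `ℤ^n → ℤ`: the smallest collection containing the
coordinate projections and constants, closed under pointwise addition,
subtraction, multiplication by an integer constant, and floor division by a
positive integer. -/
inductive QuasiAffine : ∀ {n : ℕ}, ((Fin n → ℤ) → ℤ) → Prop
  | proj {n : ℕ} (i : Fin n) : QuasiAffine (fun x => x i)
  | const {n : ℕ} (c : ℤ) : QuasiAffine (fun _ : Fin n → ℤ => c)
  | add {n : ℕ} {g h : (Fin n → ℤ) → ℤ} :
      QuasiAffine g → QuasiAffine h → QuasiAffine (fun x => g x + h x)
  | sub {n : ℕ} {g h : (Fin n → ℤ) → ℤ} :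
      QuasiAffine g → QuasiAffine h → QuasiAffine (fun x => g x - h x)
  | smul {n : ℕ} (c : ℤ) {g : (Fin n → ℤ) → ℤ} :
      QuasiAffine g → QuasiAffine (fun x => c * g x)
  | fdiv {n : ℕ} (m : ℕ) (hm : 0 < m) {g : (Fin n → ℤ) → ℤ} :
      QuasiAffine g → QuasiAffine (fun x => Int.fdiv (g x) (m : ℤ))

/-- A scalar-valued function is piecewise quasi-affine on `D`: `D` is a finite
disjoint union of Presburger-definable pieces on each of which the function
agrees with a quasi-affine function. -/
def PiecewiseQuasiAffine {n : ℕ} (D : Set (Fin n → ℤ)) (g : (Fin n → ℤ) → ℤ) : Prop :=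
  ∃ (N : ℕ) (P : Fin N → Set (Fin n → ℤ)) (q : Fin N → (Fin n → ℤ) → ℤ),
    (∀ i, Presburger (P i)) ∧
    (Pairwise fun i j => Disjoint (P i) (P j)) ∧
    (⋃ i, P i) = D ∧
    (∀ i, QuasiAffine (q i)) ∧
    (∀ i, ∀ x ∈ P i, g x = q i x)

/-- A `ℤ^k`-valued function is piecewise quasi-affine on `D`: `D` is a finite
disjoint union of Presburger-definable pieces on each of which every coordinate
of the function agrees with a quasi-affine function. -/
def PiecewiseQuasiAffineVec {n k : ℕ} (D : Set (Fin n → ℤ))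
    (g : (Fin n → ℤ) → (Fin k → ℤ)) : Prop :=
  ∃ (N : ℕ) (P : Fin N → Set (Fin n → ℤ)) (q : Fin N → Fin k → (Fin n → ℤ) → ℤ),
    (∀ i, Presburger (P i)) ∧
    (Pairwise fun i j => Disjoint (P i) (P j)) ∧
    (⋃ i, P i) = D ∧
    (∀ i j, QuasiAffine (q i j)) ∧
    (∀ i, ∀ x ∈ P i, ∀ j, g x j = q i j x)

namespace IsAffine

variable {n : ℕ} {f g : (Fin n → ℤ) → ℤ}

theorem const (c : ℤ) : IsAffine (fun _ : Fin n → ℤ => c) :=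
  ⟨0, c, fun x => by simp⟩

theorem proj (i : Fin n) : IsAffine (fun x : Fin n → ℤ => x i) :=
  ⟨Pi.single i 1, 0, fun x => by simp [Pi.single_apply]⟩

theorem add (hf : IsAffine f) (hg : IsAffine g) : IsAffine (fun x => f x + g x) := by
  obtain ⟨a, b, h⟩ := hf
  obtain ⟨a', b', h'⟩ := hg
  refine ⟨a + a', b + b', fun x => ?_⟩
  simp only [h, h', Pi.add_apply, add_mul, Finset.sum_add_distrib]
  ring

theorem mul_left (c : ℤ) (hf : IsAffine f) : IsAffine (fun x => c * f x) := by
  obtain ⟨a, b, h⟩ := hf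
  refine ⟨fun i => c * a i, c * b, fun x => ?_⟩
  simp only [h, mul_add, Finset.mul_sum, mul_assoc]

theorem sub (hf : IsAffine f) (hg : IsAffine g) : IsAffine (fun x => f x - g x) := by
  simpa [sub_eq_add_neg] using hf.add (hg.mul_left (-1))

theorem comp_init {f : (Fin n → ℤ) → ℤ} (hf : IsAffine f) :
    IsAffine (fun x : Fin (n + 1) → ℤ => f (Fin.init x)) := by
  obtain ⟨a, b, h⟩ := hf
  refine ⟨Fin.snoc a 0, b, fun x => ?_⟩
  simp [h, Fin.sum_univ_castSucc, Fin.init]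

theorem comp_snoc {f : (Fin (n + 1) → ℤ) → ℤ} (hf : IsAffine f) :
    ∃ h : (Fin n → ℤ) → ℤ, IsAffine h ∧ ∃ α : ℤ, ∀ p v, f (Fin.snoc p v) = h p + α * v := by
  obtain ⟨a, b, h⟩ := hf
  refine ⟨_, ⟨Fin.init a, b, fun _ => rfl⟩, a (Fin.last n), fun p v => ?_⟩
  simp [h, Fin.sum_univ_castSucc, Fin.init, add_assoc]

theorem quasiAffine (hf : IsAffine f) : QuasiAffine f := by
  obtain ⟨a, b, h⟩ := hf
  have key : ∀ s : Finset (Fin n), QuasiAffine (fun x => b + ∑ i ∈ s, a i * x i) := by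
    intro s
    induction s using Finset.induction_on with
    | empty => simpa using QuasiAffine.const b
    | insert i s hi ih =>
      have := ih.add (.smul (a i) (.proj i))
      simp only [Finset.sum_insert hi]
      convert this using 2
      ring
  rw [funext h]
  exact key _

end IsAffine

/-- Functions of the form `x ↦ ⌊f x / a⌋` with `f` affine and `a` a positive integer. -/
def IsFloorAffine {n : ℕ} (c : (Fin n → ℤ) → ℤ) : Prop :=
  ∃ f : (Fin n → ℤ) → ℤ, IsAffine f ∧ ∃ a : ℕ, 0 < a ∧ ∀ x, c x = Int.fdiv (f x) a

theorem Int.le_fdiv_natCast_iff {a : ℕ} (ha : 0 < a) (v y : ℤ) :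
    v ≤ Int.fdiv y a ↔ a * v ≤ y := by
  rw [Int.fdiv_eq_ediv_of_nonneg _ (by positivity), Int.le_ediv_iff_mul_le (by exact_mod_cast ha),
    mul_comm]

namespace IsFloorAffine

variable {n : ℕ} {c : (Fin n → ℤ) → ℤ}

theorem quasiAffine (hc : IsFloorAffine c) : QuasiAffine c := by
  obtain ⟨f, hf, a, ha, h⟩ := hc
  rw [funext h]
  exact hf.quasiAffine.fdiv a ha

theorem sub_const (hc : IsFloorAffine c) (j : ℤ) : IsFloorAffine (fun x => c x - j) := by
  obtain ⟨f, hf, a, ha, h⟩ := hc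
  refine ⟨_, hf.sub (.const (a * j)), a, ha, fun x => ?_⟩
  beta_reduce
  rw [h, Int.fdiv_eq_ediv_of_nonneg _ (by positivity), Int.fdiv_eq_ediv_of_nonneg _ (by positivity),
    Int.sub_mul_ediv_left _ _ (by positivity)]

end IsFloorAffine

namespace Presburger

variable {m n : ℕ}

theorem univ : Presburger (Set.univ : Set (Fin n → ℤ)) := by
  simpa using affineGe _ (IsAffine.const (n := n) 0)

theorem empty : Presburger (∅ : Set (Fin n → ℤ)) := by
  simpa using (univ (n := n)).compl

theorem sdiff {S T : Set (Fin n → ℤ)} (hS : Presburger S) (hT : Presburger T) :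
    Presburger (S \ T) := hS.inter hT.compl

theorem biUnion_finset {ι : Type*} {S : ι → Set (Fin n → ℤ)} (hS : ∀ i, Presburger (S i))
    (s : Finset ι) : Presburger (⋃ i ∈ s, S i) := by
  classical
  induction s using Finset.induction_on with
  | empty => simpa using empty
  | insert i s _ ih =>
    rw [Finset.set_biUnion_insert]
    exact (hS i).union ih

theorem iUnion {ι : Type*} [Finite ι] {S : ι → Set (Fin n → ℤ)} (hS : ∀ i, Presburger (S i)) :
    Presburger (⋃ i, S i) := by
  have := Fintype.ofFinite ι
  simpa using biUnion_finset hS Finset.univ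

theorem iInter {ι : Type*} [Finite ι] {S : ι → Set (Fin n → ℤ)} (hS : ∀ i, Presburger (S i)) :
    Presburger (⋂ i, S i) := by
  rw [← compl_compl (⋂ i, S i), Set.compl_iInter]
  exact (iUnion fun i => (hS i).compl).compl

theorem disjointed {ι : Type*} [Preorder ι] [LocallyFiniteOrderBot ι]
    {S : ι → Set (Fin n → ℤ)} (hS : ∀ i, Presburger (S i)) (i : ι) :
    Presburger (disjointed S i) := by
  rw [disjointed_apply, Finset.sup_set_eq_biUnion]
  exact (hS i).sdiff (biUnion_finset hS _)

/-- Substituting a function `⌊f p / a⌋` for the parameter `v` of an affine family `φ p v`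
preserves Presburger definability. -/
theorem preimage_fdiv {φ : (Fin m → ℤ) → ℤ → (Fin n → ℤ)}
    (hφ : ∀ f, IsAffine f → ∃ h, IsAffine h ∧ ∃ α : ℤ, ∀ p v, f (φ p v) = h p + α * v)
    {S : Set (Fin n → ℤ)} (hS : Presburger S) {c : (Fin m → ℤ) → ℤ} (hc : IsFloorAffine c) :
    Presburger {p | φ p (c p) ∈ S} := by
  obtain ⟨f, hf, a, ha, hc⟩ := hc
  have ha' : (0 : ℤ) < a := by exact_mod_cast ha
  have hmod : ∀ p, f p = a * c p + f p % a := fun p => by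
    rw [hc, Int.fdiv_eq_ediv_of_nonneg _ ha'.le, Int.mul_ediv_add_emod]
  have hsplit : ∀ (A : Set (Fin m → ℤ)) (B : Fin a → Set (Fin m → ℤ)), (∀ r, Presburger (B r)) →
      (∀ (r : Fin a) p, (r : ℤ) = f p % a → (p ∈ A ↔ p ∈ B r)) → Presburger A := by
    intro A B hB hAB
    have : A = ⋃ r : Fin a, {p | (a : ℤ) ∣ f p - r} ∩ B r := by
      ext p
      simp only [Set.mem_iUnion, Set.mem_inter_iff, Set.mem_ofPred_eq]
      constructor
      · intro hp
        have h0 := Int.emod_nonneg (f p) ha'.ne'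
        have h1 := Int.emod_lt_of_pos (f p) ha'
        have hr : ((⟨(f p % a).toNat, by omega⟩ : Fin a) : ℤ) = f p % a := Int.toNat_of_nonneg h0
        exact ⟨_, by rw [hr]; exact Int.dvd_self_sub_emod, (hAB _ p hr).1 hp⟩
      · rintro ⟨r, hr, hp⟩
        refine (hAB r p ?_).2 hp
        rw [← (Int.modEq_iff_dvd.2 hr).eq,
          Int.emod_eq_of_lt (by positivity) (by exact_mod_cast r.2)]
    rw [this]
    exact iUnion fun r => (dvd a ha _ (hf.sub (.const _))).inter (hB r)
  induction hS with
  | affineGe g hg =>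
    obtain ⟨h, hh, α, hα⟩ := hφ g hg
    refine hsplit _ _ (fun r => affineGe (fun p => a * h p + α * (f p - r))
      ((hh.mul_left _).add ((hf.sub (.const _)).mul_left _))) fun r p hr => ?_
    have : a * h p + α * (f p - r) = a * (h p + α * c p) := by
      rw [hr]; linear_combination α * hmod p
    simp only [Set.mem_ofPred_eq, hα, this, mul_nonneg_iff_of_pos_left ha']
  | dvd k hk g hg =>
    obtain ⟨h, hh, α, hα⟩ := hφ g hg
    refine hsplit _ _ (fun r => dvd (a * k) (by positivity) (fun p => a * h p + α * (f p - r))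
      ((hh.mul_left _).add ((hf.sub (.const _)).mul_left _))) fun r p hr => ?_
    have : a * h p + α * (f p - r) = a * (h p + α * c p) := by
      rw [hr]; linear_combination α * hmod p
    simp only [Set.mem_ofPred_eq, hα, this, Nat.cast_mul, mul_dvd_mul_iff_left ha'.ne']
  | union _ _ ihS ihT => exact ihS.union ihT
  | inter _ _ ihS ihT => exact ihS.inter ihT
  | compl _ ih => exact ih.compl

/-- Along an affine family `φ p v`, membership in a Presburger-definable set is periodic in `v`
between finitely many thresholds of the form `⌊f p / a⌋`. -/
theorem exists_period_thresholds {φ : (Fin m → ℤ) → ℤ → (Fin n → ℤ)}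
    (hφ : ∀ f, IsAffine f → ∃ h, IsAffine h ∧ ∃ α : ℤ, ∀ p v, f (φ p v) = h p + α * v)
    {S : Set (Fin n → ℤ)} (hS : Presburger S) :
    ∃ M : ℕ, 0 < M ∧ ∃ F : Set ((Fin m → ℤ) → ℤ), F.Finite ∧ (∀ c ∈ F, IsFloorAffine c) ∧
      ∀ p v w, v ≤ w → (M : ℤ) ∣ w - v → (∀ c ∈ F, ¬ (v ≤ c p ∧ c p < w)) →
        (φ p v ∈ S ↔ φ p w ∈ S) := by
  induction hS with
  | affineGe g hg =>
    obtain ⟨h, hh, α, hα⟩ := hφ g hg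
    rcases lt_trichotomy α 0 with hneg | rfl | hpos
    · lift -α to ℕ using by omega with a ha
      have ha0 : 0 < a := by omega
      refine ⟨1, one_pos, {fun p => Int.fdiv (h p) a}, Set.finite_singleton _, ?_, ?_⟩
      · rintro _ rfl
        exact ⟨h, hh, a, ha0, fun _ => rfl⟩
      · intro p v w hvw _ hF
        have hF := hF _ rfl
        rw [← not_le, Int.le_fdiv_natCast_iff ha0, Int.le_fdiv_natCast_iff ha0, ha] at hF
        have : α * w ≤ α * v := mul_le_mul_of_nonpos_left hvw hneg.le
        simp only [Set.mem_ofPred_eq, hα]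
        grind
    · exact ⟨1, one_pos, ∅, Set.finite_empty, by simp, by simp [hα]⟩
    · lift α to ℕ using hpos.le
      have ha0 : 0 < α := by omega
      refine ⟨1, one_pos, {fun p => Int.fdiv ((-1) * h p - 1) α}, Set.finite_singleton _, ?_, ?_⟩
      · rintro _ rfl
        exact ⟨_, (hh.mul_left _).sub (.const 1), α, ha0, fun _ => rfl⟩
      · intro p v w hvw _ hF
        have hF := hF _ rfl
        rw [← not_le, Int.le_fdiv_natCast_iff ha0, Int.le_fdiv_natCast_iff ha0] at hF
        have : (α : ℤ) * v ≤ α * w := mul_le_mul_of_nonneg_left hvw hpos.le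
        simp only [Set.mem_ofPred_eq, hα]
        grind
  | dvd k hk g hg =>
    obtain ⟨h, hh, α, hα⟩ := hφ g hg
    refine ⟨k, hk, ∅, Set.finite_empty, by simp, fun p v w _ hk _ => ?_⟩
    simp only [Set.mem_ofPred_eq, hα]
    have : h p + α * w = h p + α * v + α * (w - v) := by ring
    rw [this, dvd_add_left (hk.mul_left α)]
  | union _ _ ihS ihT | inter _ _ ihS ihT =>
    obtain ⟨M, hM, F, hF, hFc, h⟩ := ihS
    obtain ⟨M', hM', F', hF', hFc', h'⟩ := ihT
    refine ⟨M * M', by positivity, F ∪ F', hF.union hF', ?_, fun p v w hvw hd hs => ?_⟩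
    · rintro c (hc | hc)
      exacts [hFc c hc, hFc' c hc]
    · push_cast at hd
      have h1 := h p v w hvw (dvd_of_mul_right_dvd hd) fun c hc => hs c (.inl hc)
      have h2 := h' p v w hvw (dvd_of_mul_left_dvd hd) fun c hc => hs c (.inr hc)
      simp only [Set.mem_union, Set.mem_inter_iff, h1, h2]
  | compl _ ih =>
    obtain ⟨M, hM, F, hF, hFc, h⟩ := ih
    exact ⟨M, hM, F, hF, hFc, fun p v w hvw hd hs => not_congr (h p v w hvw hd hs)⟩

/-- The greatest elements of the fibres of a Presburger-definable set are among the values of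
finitely many functions of the form `⌊f p / a⌋`. -/
theorem exists_finite_isGreatest_candidates {S : Set (Fin (m + 1) → ℤ)} (hS : Presburger S) :
    ∃ C : Set ((Fin m → ℤ) → ℤ), C.Finite ∧ (∀ c ∈ C, IsFloorAffine c) ∧
      ∀ p v, IsGreatest {v | (Fin.snoc p v : Fin (m + 1) → ℤ) ∈ S} v → ∃ c ∈ C, v = c p := by
  obtain ⟨M, hM, F, hF, hFc, h⟩ :=
    hS.exists_period_thresholds (φ := fun p v => Fin.snoc p v) fun f hf => hf.comp_snoc
  refine ⟨Set.image2 (fun c (j : ℤ) p => c p - j) F (Set.Ico 0 (M : ℤ)),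
    hF.image2 _ (Set.finite_Ico _ _), ?_, fun p v hv => ?_⟩
  · rintro _ ⟨c, hc, j, -, rfl⟩
    exact (hFc c hc).sub_const j
  · by_contra! hne
    have : v + M ≤ v := hv.2 <| (h p v (v + M) (by omega) (by simp) fun c hc hvc => ?_).1 hv.1
    · omega
    · exact hne _ ⟨c, hc, c p - v, ⟨by omega, by omega⟩, rfl⟩ (by ring)

/-- If the fibres of a Presburger-definable set are bounded above, its projection is
Presburger-definable and the fibrewise maximum is piecewise quasi-affine. -/
theorem exists_piecewiseQuasiAffine_isGreatest {S : Set (Fin (m + 1) → ℤ)} (hS : Presburger S)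
    (hb : ∀ p : Fin m → ℤ, BddAbove {v | (Fin.snoc p v : Fin (m + 1) → ℤ) ∈ S}) :
    Presburger {p : Fin m → ℤ | ∃ v : ℤ, Fin.snoc p v ∈ S} ∧
      ∃ g : (Fin m → ℤ) → ℤ, PiecewiseQuasiAffine {p | ∃ v : ℤ, Fin.snoc p v ∈ S} g ∧
        ∀ p, (∃ v : ℤ, (Fin.snoc p v : Fin (m + 1) → ℤ) ∈ S) →
          IsGreatest {v : ℤ | (Fin.snoc p v : Fin (m + 1) → ℤ) ∈ S} (g p) := by
  have hmax : ∀ p : Fin m → ℤ, ∃ g : ℤ, (∃ v : ℤ, (Fin.snoc p v : Fin (m + 1) → ℤ) ∈ S) →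
      IsGreatest {v : ℤ | (Fin.snoc p v : Fin (m + 1) → ℤ) ∈ S} g := by
    intro p
    by_cases hp : ∃ v : ℤ, (Fin.snoc p v : Fin (m + 1) → ℤ) ∈ S
    · obtain ⟨b, hb⟩ := hb p
      obtain ⟨g, hg, hg'⟩ := Int.exists_greatest_of_bdd ⟨b, fun z hz => hb hz⟩ hp
      exact ⟨g, fun _ => ⟨hg, hg'⟩⟩
    · exact ⟨0, fun h => absurd h hp⟩
  choose g hg using hmax
  obtain ⟨C, hC, hCc, hcand⟩ := hS.exists_finite_isGreatest_candidates
  have := hC.to_subtype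
  obtain ⟨N, ⟨e⟩⟩ := Finite.exists_equiv_fin C
  let c : Fin N → (Fin m → ℤ) → ℤ := fun i => (e.symm i).1
  have hc : ∀ i, IsFloorAffine (c i) := fun i => hCc _ (e.symm i).2
  have hsub : ∀ (T : Set (Fin (m + 1) → ℤ)), Presburger T → ∀ i,
      Presburger {p | (Fin.snoc p (c i p) : Fin (m + 1) → ℤ) ∈ T} := fun T hT i =>
    hT.preimage_fdiv (φ := fun p v => Fin.snoc p v) (fun f hf => hf.comp_snoc) (hc i)
  have hle : ∀ i j, Presburger {p | c i p ≤ c j p} := by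
    intro i j
    obtain ⟨f, hf, a, ha, hj⟩ := hc j
    simpa [hj, Int.le_fdiv_natCast_iff ha] using
      hsub _ (affineGe _ (hf.comp_init.sub ((IsAffine.proj (Fin.last m)).mul_left a))) i
  let Q : Fin N → Set (Fin m → ℤ) := fun i => {p | (Fin.snoc p (c i p) : Fin (m + 1) → ℤ) ∈ S} ∩
    ⋂ j, ({p | (Fin.snoc p (c j p) : Fin (m + 1) → ℤ) ∈ S}ᶜ ∪ {p | c j p ≤ c i p})
  have hQ : ∀ i, Presburger (Q i) := fun i =>
    (hsub S hS i).inter (iInter fun j => (hsub S hS j).compl.union (hle j i))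
  have hQg : ∀ i, ∀ p ∈ Q i, g p = c i p := by
    rintro i p ⟨hp, hp'⟩
    have hgp := hg p ⟨_, hp⟩
    obtain ⟨d, hd, hgd⟩ := hcand p _ hgp
    have hd' : c (e ⟨d, hd⟩) p = g p := by simp [c, hgd]
    refine le_antisymm ?_ (hgp.2 hp)
    rcases Set.mem_iInter.1 hp' (e ⟨d, hd⟩) with h | h
    · exact absurd hgp.1 (by simpa [hd'] using h)
    · simpa [hd'] using h
  have hQD : ⋃ i, Q i = {p | ∃ v : ℤ, Fin.snoc p v ∈ S} := by
    ext p
    simp only [Set.mem_iUnion, Set.mem_ofPred_eq]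
    refine ⟨fun ⟨i, hp⟩ => ⟨_, hp.1⟩, fun hp => ?_⟩
    obtain ⟨d, hd, hgd⟩ := hcand p _ (hg p hp)
    have hd' : c (e ⟨d, hd⟩) p = g p := by simp [c, hgd]
    refine ⟨e ⟨d, hd⟩, ?_, Set.mem_iInter.2 fun j => ?_⟩
    · simpa [hd'] using (hg p hp).1
    · exact not_or_of_imp fun hj => ((hg p hp).2 hj).trans_eq hd'.symm
  refine ⟨hQD ▸ iUnion hQ, g, ⟨N, _root_.disjointed Q, c, disjointed hQ, disjoint_disjointed Q,
    iUnion_disjointed.trans hQD, fun i => (hc i).quasiAffine, fun i p hp =>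
    hQg i p (disjointed_subset Q i hp)⟩, hg⟩

end Presburger

/-- **Correctness of the `Fold` operation** (equation (3) of the paper).
Given affine loop bounds `e₁, e₂ : ℤ^m → ℤ` and a Presburger-definable set
`S ⊆ ℤ^m × ℤ` (pairs encoded via `Fin.snoc`), the set `D` of parameters `p`
for which some `v ∈ [e₁ p, e₂ p]` satisfies `(p, v) ∈ S` is
Presburger-definable; for each `p ∈ D` the set
`{v | e₁ p ≤ v ≤ e₂ p ∧ (p, v) ∈ S}` has a greatest element, and the function
sending `p` to this greatest element is piecewise quasi-affine on `D`. -/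
theorem fold_correctness (m : ℕ) (e₁ e₂ : (Fin m → ℤ) → ℤ)
    (he₁ : IsAffine e₁) (he₂ : IsAffine e₂)
    (S : Set (Fin (m + 1) → ℤ)) (hS : Presburger S)
    (D : Set (Fin m → ℤ))
    (hD : D = {p | ∃ v : ℤ, e₁ p ≤ v ∧ v ≤ e₂ p ∧ Fin.snoc p v ∈ S}) :
    Presburger D ∧
    ∃ g : (Fin m → ℤ) → ℤ,
      PiecewiseQuasiAffine D g ∧
      ∀ p ∈ D,
        (e₁ p ≤ g p ∧ g p ≤ e₂ p ∧ Fin.snoc p (g p) ∈ S) ∧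
        ∀ v : ℤ, e₁ p ≤ v → v ≤ e₂ p → Fin.snoc p v ∈ S → v ≤ g p := by
  subst hD
  have hT := (hS.inter (.affineGe _ ((IsAffine.proj (Fin.last m)).sub he₁.comp_init))).inter
    (.affineGe _ (he₂.comp_init.sub (IsAffine.proj (Fin.last m))))
  have hmem : ∀ (p : Fin m → ℤ) (v : ℤ), (Fin.snoc p v : Fin (m + 1) → ℤ) ∈
      S ∩ {x | 0 ≤ x (Fin.last m) - e₁ (Fin.init x)} ∩
        {x | 0 ≤ e₂ (Fin.init x) - x (Fin.last m)} ↔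
      e₁ p ≤ v ∧ v ≤ e₂ p ∧ (Fin.snoc p v : Fin (m + 1) → ℤ) ∈ S := by
    intro p v
    simp only [Set.mem_inter_iff, Set.mem_ofPred_eq, Fin.snoc_last, Fin.init_snoc, sub_nonneg]
    tauto
  obtain ⟨hD, g, hg, hmax⟩ := hT.exists_piecewiseQuasiAffine_isGreatest fun p =>
    ⟨e₂ p, fun v hv => ((hmem p v).1 hv).2.1⟩
  simp only [hmem] at hD hg hmax
  exact ⟨hD, g, hg, fun p hp => ⟨(hmax p hp).1, fun v h₁ h₂ hv => (hmax p hp).2 ⟨h₁, h₂, hv⟩⟩⟩
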